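/- There exists a constant M > 0 such that for all sufficiently large n, for all p with 1/(2n) < p < 2/n, and for all 1 ≤ m ≤ n^{2/3}: E[‖T_m‖⁴] ≤ M·m² and E[a(T_m)²] ≤ M·m³. -/

import Mathlib

open Finset
open scoped Classical

namespace RandomTree

/-- The state of the depth-first exploration: the ordered stack of open vertices and the
list of explored vertices, in order of exploration. -/
structure St (m : ℕ) where
  stack : List (Fin m)
  visited : List (Fin m)

/-- One step of the depth-first exploration of the graph with adjacency `adj`. -/
def step {m : ℕ} (adj : Fin m → Fin m → Bool) (s : St m) : St m :=
  match s.stack with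
  | [] => s
  | v :: rest =>
    let visited' := s.visited ++ [v]
    let ns := (List.finRange m).filter
      (fun w => adj v w && !(decide (w ∈ s.stack)) && !(decide (w ∈ s.visited)))
    let stack' := ns ++ rest
    let stack'' := if stack'.isEmpty then
        ((List.finRange m).filter (fun w => !(decide (w ∈ visited')))).take 1
      else stack'
    ⟨stack'', visited', ⟩

/-- The state of the depth-first exploration started at the root `r` after `i` steps. -/
def stateAt {m : ℕ} (adj : Fin m → Fin m → Bool) (r : Fin m) (i : ℕ) : St m :=
  (step adj)^[i] ⟨[r], []⟩

/-- `par` is the parent map of a tree on `Fin m` rooted at `r`: iterating the parent map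
from any vertex leads to the root. -/
def IsPTree {m : ℕ} (par : Fin m → Fin m) (r : Fin m) : Prop :=
  par r = r ∧ ∀ v, ∃ k : ℕ, par^[k] v = r

/-- The set of (parent maps of) labelled trees on `Fin m` rooted at `r`. -/
noncomputable def treeFinset (m : ℕ) (r : Fin m) : Finset (Fin m → Fin m) :=
  univ.filter (fun par => IsPTree par r)

/-- The adjacency function of the canonical plane embedding of the tree with parent map
`par`: edges from each vertex to its children (children are listed in increasing order of
label by the exploration itself). -/
def childAdj {m : ℕ} (par : Fin m → Fin m) (r : Fin m) : Fin m → Fin m → Bool :=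
  fun v w => decide (w ≠ r) && decide (par w = v)

/-- The depth-first (planar) order of the vertices of the tree, as a list
`[v₁, …, v_m]`. -/
def dfsOrder {m : ℕ} (par : Fin m → Fin m) (r : Fin m) : List (Fin m) :=
  (stateAt (childAdj par r) r m).visited

/-- The position of a vertex in the depth-first (planar) order. -/
def dfsPos {m : ℕ} (par : Fin m → Fin m) (r : Fin m) (v : Fin m) : ℕ :=
  (dfsOrder par r).findIdx (fun w => decide (w = v))

/-- The number of vertices of the subtree rooted at `v` (including `v`). -/
noncomputable def subSize {m : ℕ} (par : Fin m → Fin m) (v : Fin m) : ℕ :=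
  Set.ncard {w : Fin m | ∃ k : ℕ, par^[k] w = v}

/-- The number of vertices of the subtree rooted at `v` lying outside the largest of the
subtrees rooted at a child of `v`. -/
noncomputable def outsideLargest {m : ℕ} (par : Fin m → Fin m) (r : Fin m) (v : Fin m) : ℕ :=
  subSize par v - (univ.filter (fun c : Fin m => c ≠ r ∧ par c = v)).sup (subSize par)


/-- The permitted edges of the plane tree with parent map `par`: ordered pairs `(u, v)`
of distinct vertices, with `u` before `v` in the planar order (so `u` is the tail and `v`
the head), which at some step of the depth-first exploration are simultaneously on the
stack. -/
noncomputable def permitted {m : ℕ} (par : Fin m → Fin m) (r : Fin m) :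
    Finset (Fin m × Fin m) :=
  univ.filter (fun x : Fin m × Fin m => x.1 ≠ x.2 ∧
    dfsPos par r x.1 < dfsPos par r x.2 ∧
    ∃ i ≤ m, x.1 ∈ (stateAt (childAdj par r) r i).stack ∧
      x.2 ∈ (stateAt (childAdj par r) r i).stack)


/-- The number `a(T)` of permitted edges ("area") of the plane tree with parent map `par`. -/
noncomputable def area {m : ℕ} (par : Fin m → Fin m) (r : Fin m) : ℕ :=
  (permitted par r).card

/-- The height of the vertex `v`: its distance to the root. -/
noncomputable def hgt {m : ℕ} (par : Fin m → Fin m) (r : Fin m) (v : Fin m) : ℕ :=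
  sInf {k : ℕ | par^[k] v = r}

/-- The height `‖T‖` of the tree: the largest distance from the root to a vertex. -/
noncomputable def treeHeight {m : ℕ} (par : Fin m → Fin m) (r : Fin m) : ℕ :=
  univ.sup (hgt par r)

/-- The expectation, under the law of the random tree `T_m` (a uniform labelled tree on
`[m]` rooted at `1`, biased by `(1-p)^{-a(·)}`), of a functional `f` of the tree. -/
noncomputable def biasedExp (m : ℕ) (p : ℝ) (f : (Fin m → Fin m) → Fin m → ℝ) : ℝ :=
  if h : 0 < m then
    let r : Fin m := ⟨0, h⟩
    (∑ par ∈ treeFinset m r, ((1 - p) ^ area par r)⁻¹ * f par r)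
      / (∑ par ∈ treeFinset m r, ((1 - p) ^ area par r)⁻¹)
  else 0

end RandomTree

namespace RandomTree

section Forest

variable {α : Type*} [DecidableEq α]

/-- The children of the roots of a forest. -/
def firstGen (A U : Finset α) (f : α → α) : Finset α :=
  U.filter fun x => f x ∈ A

/-- The parent map of the forest obtained by turning the vertices of `B` into roots. -/
def cutAt (B : Finset α) (f : α → α) : α → α :=
  fun x => if x ∈ B then x else f x

/-- The number of steps that a vertex needs to reach `A`. -/
noncomputable def depth (A : Finset α) (f : α → α) (x : α) : ℕ :=
  sInf {k : ℕ | f^[k] x ∈ A}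

lemma iterate_succ_mem_of_cutAt {A U B : Finset α} {f : α → α} (hAU : Disjoint A U)
    (hfix : ∀ x, x ∉ U → f x = x) (hB : ∀ x ∈ B, f x ∈ A) (k : ℕ) :
    ∀ x, (cutAt B f)^[k] x ∈ B → f^[k + 1] x ∈ A := by
  induction k with
  | zero => intro x hx; simpa using hB x hx
  | succ k ih =>
    intro x hx
    rw [Function.iterate_succ_apply]
    by_cases hxB : x ∈ B
    · have h1 : f x ∈ A := hB x hxB
      have h2 : f (f x) = f x := hfix _ (fun h => Finset.disjoint_left.1 hAU h1 h)
      rw [Function.iterate_fixed h2]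
      exact h1
    · rw [Function.iterate_succ_apply] at hx
      have : cutAt B f x = f x := by simp [cutAt, hxB]
      rw [this] at hx
      exact ih _ hx

lemma exists_cutAt_iterate_mem {A U : Finset α} {f : α → α} (hAU : Disjoint A U)
    (hfix : ∀ x, x ∉ U → f x = x) (k : ℕ) :
    ∀ x ∈ U, f^[k] x ∈ A → ∃ j : ℕ, (cutAt (firstGen A U f) f)^[j] x ∈ firstGen A U f := by
  induction k with
  | zero => intro x hx hxA; exact absurd hx (Finset.disjoint_left.1 hAU hxA)
  | succ k ih =>
    intro x hx hk
    by_cases hxB : x ∈ firstGen A U f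
    · exact ⟨0, hxB⟩
    · have hfx : f x ∉ A := fun h => hxB (by simp [firstGen, hx, h])
      rw [Function.iterate_succ_apply] at hk
      have hU : f x ∈ U := by
        by_contra h
        rw [Function.iterate_fixed (hfix _ h)] at hk
        exact hfx hk
      obtain ⟨j, hj⟩ := ih _ hU hk
      refine ⟨j + 1, ?_⟩
      rw [Function.iterate_succ_apply]
      have : cutAt (firstGen A U f) f x = f x := by simp [cutAt, hxB]
      rwa [this]

/-- `s (s + n) ^ (n - 1)`; for `s` a positive integer, the number of forests with `s` roots and
`n` other vertices. -/
noncomputable def forestCount (s : ℝ) (n : ℕ) : ℝ := s * (s + n) ^ n / (s + n)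

lemma choose_mul_forestCount (n b : ℕ) (s : ℝ) (hb : b ≤ n) :
    ((n + 1).choose (b + 1) : ℝ) * (s ^ (b + 1) * forestCount (b + 1 : ℕ) (n - b)) =
      s * (n.choose b * s ^ b * ((n + 1 : ℕ) : ℝ) ^ (n - b)) := by
  have h1 : ((n + 1 : ℕ) : ℝ) * n.choose b = (n + 1).choose (b + 1) * (b + 1 : ℕ) := by
    exact_mod_cast Nat.add_one_mul_choose_eq n b
  have h2 : ((b + 1 : ℕ) : ℝ) + ((n - b : ℕ) : ℝ) = (n + 1 : ℕ) := by
    rw [← Nat.cast_add]; congr 1; omega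
  have h3 : ((n + 1 : ℕ) : ℝ) ≠ 0 := by positivity
  rw [forestCount, h2]
  field_simp
  linear_combination (-s ^ (b + 1)) * h1

lemma sum_powerset_forestCount {U : Finset α} {n : ℕ} (hU : #U = n + 1) (s : ℝ) (G : ℕ → ℝ) :
    ∑ B ∈ U.powerset, s ^ #B * (forestCount #B #(U \ B) * G #B) =
      s * ∑ b ∈ Finset.range (n + 1),
        n.choose b * s ^ b * ((n + 1 : ℕ) : ℝ) ^ (n - b) * G (b + 1) := by
  have h1 : ∀ B ∈ U.powerset, s ^ #B * (forestCount #B #(U \ B) * G #B) =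
      (fun b : ℕ => s ^ b * (forestCount b (n + 1 - b) * G b)) #B := by
    intro B hB
    have : #(U \ B) = n + 1 - #B := by
      rw [Finset.card_sdiff_of_subset (Finset.mem_powerset.1 hB), hU]
    simp only [this]
  rw [Finset.sum_congr rfl h1, Finset.sum_powerset_apply_card
    (fun b : ℕ => s ^ b * (forestCount b (n + 1 - b) * G b)), hU, Finset.sum_range_succ']
  have h0 : forestCount ((0 : ℕ) : ℝ) (n + 1 - 0) = 0 := by simp [forestCount]
  rw [h0]
  simp only [zero_mul, mul_zero, smul_zero, add_zero, nsmul_eq_mul]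
  rw [Finset.mul_sum]
  refine Finset.sum_congr rfl fun b hb => ?_
  have hb' : b ≤ n := Nat.lt_succ_iff.1 (Finset.mem_range.1 hb)
  have h2 : n + 1 - (b + 1) = n - b := by omega
  rw [h2]
  linear_combination G (b + 1) * choose_mul_forestCount n b s hb'

lemma sum_choose_eq_forestCount (n : ℕ) {s : ℝ} (hs : 0 ≤ s) :
    s * ∑ b ∈ Finset.range (n + 1), n.choose b * s ^ b * ((n + 1 : ℕ) : ℝ) ^ (n - b) =
      forestCount s (n + 1) := by
  have h : s + ((n + 1 : ℕ) : ℝ) ≠ 0 := by positivity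
  rw [forestCount, pow_succ, ← mul_assoc, mul_div_assoc, div_self h, mul_one, add_pow]
  congr 1
  refine Finset.sum_congr rfl fun b _ => ?_
  ring

variable [Fintype α]

/-- The rooted forests with root set `A` and set of non-root vertices `U`, given by their
parent maps, extended by the identity outside `U`. -/
noncomputable def forests (A U : Finset α) : Finset (α → α) :=
  univ.filter fun f => (∀ x, x ∉ U → f x = x) ∧ ∀ x ∈ U, ∃ k : ℕ, f^[k] x ∈ A

lemma mem_forests {A U : Finset α} {f : α → α} :
    f ∈ forests A U ↔ (∀ x, x ∉ U → f x = x) ∧ ∀ x ∈ U, ∃ k : ℕ, f^[k] x ∈ A := by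
  simp [forests]

lemma cutAt_mem_forests {A U : Finset α} {f : α → α} (hAU : Disjoint A U)
    (hf : f ∈ forests A U) :
    cutAt (firstGen A U f) f ∈ forests (firstGen A U f) (U \ firstGen A U f) := by
  rw [mem_forests] at hf ⊢
  refine ⟨fun x hx => ?_, fun x hx => ?_⟩
  · by_cases hxB : x ∈ firstGen A U f
    · simp [cutAt, hxB]
    · have : x ∉ U := fun h => hx (by simp [h, hxB])
      simp [cutAt, hxB, hf.1 x this]
  · have hxU : x ∈ U := (Finset.mem_sdiff.1 hx).1
    obtain ⟨k, hk⟩ := hf.2 x hxU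
    exact exists_cutAt_iterate_mem hAU hf.1 k x hxU hk

lemma graft_mem {A U B : Finset α} (hAU : Disjoint A U) (hBU : B ⊆ U) {φ g : α → α}
    (hφ : ∀ x ∈ B, φ x ∈ A) (hg : g ∈ forests B (U \ B)) :
    (fun x => if x ∈ B then φ x else g x) ∈ forests A U ∧
      firstGen A U (fun x => if x ∈ B then φ x else g x) = B ∧
      cutAt B (fun x => if x ∈ B then φ x else g x) = g := by
  rw [mem_forests] at hg
  set f : α → α := fun x => if x ∈ B then φ x else g x with hf
  have hfix : ∀ x, x ∉ U → f x = x := by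
    intro x hx
    have hxB : x ∉ B := fun h => hx (hBU h)
    simp only [hf, hxB, if_false]
    exact hg.1 x (by simp [hx])
  have hcut : cutAt B f = g := by
    funext x
    by_cases hxB : x ∈ B
    · simp [cutAt, hxB, hg.1 x]
    · simp [cutAt, hxB, hf]
  have hB : ∀ x ∈ B, f x ∈ A := by
    intro x hx
    simpa [hf, hx] using hφ x hx
  refine ⟨mem_forests.2 ⟨hfix, fun x hx => ?_⟩, ?_, hcut⟩
  · by_cases hxB : x ∈ B
    · exact ⟨1, by simpa using hB x hxB⟩
    · obtain ⟨k, hk⟩ := hg.2 x (by simp [hx, hxB])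
      refine ⟨k + 1, iterate_succ_mem_of_cutAt hAU hfix hB k x ?_⟩
      rwa [hcut]
  · ext x
    simp only [firstGen, Finset.mem_filter]
    constructor
    · rintro ⟨hxU, hxA⟩
      by_contra hxB
      have hfx : f x = g x := by simp [hf, hxB]
      rw [hfx] at hxA
      obtain ⟨k, hk⟩ := hg.2 x (by simp [hxU, hxB])
      have hgU : g x ∉ U := Finset.disjoint_left.1 hAU hxA
      have hgg : g (g x) = g x := hg.1 _ (by simp [hgU])
      cases k with
      | zero => exact hxB hk
      | succ k =>
        rw [Function.iterate_succ_apply, Function.iterate_fixed hgg] at hk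
        exact hgU (hBU hk)
    · intro hx
      exact ⟨hBU hx, hB x hx⟩

/-- Summation over forests by cutting off the roots: the children of the roots form a set `B`,
their parents are arbitrary, and they are the roots of an arbitrary forest. -/
lemma sum_forests_eq_sum_powerset {A U : Finset α} (hAU : Disjoint A U)
    (H : Finset α → (α → α) → ℝ) :
    ∑ f ∈ forests A U, H (firstGen A U f) (cutAt (firstGen A U f) f) =
      ∑ B ∈ U.powerset, (#A : ℝ) ^ #B * ∑ g ∈ forests B (U \ B), H B g := by
  have hmaps : ∀ f ∈ forests A U, firstGen A U f ∈ U.powerset := fun f _ =>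
    Finset.mem_powerset.2 (Finset.filter_subset _ _)
  rw [← Finset.sum_fiberwise_of_maps_to hmaps]
  refine Finset.sum_congr rfl fun B hB => ?_
  have hBU : B ⊆ U := Finset.mem_powerset.1 hB
  set P : Finset (α → α) := Fintype.piFinset fun x => if x ∈ B then A else {x} with hP
  have hPcard : (#P : ℝ) = (#A : ℝ) ^ #B := by
    rw [hP, Fintype.card_piFinset]
    push_cast
    rw [← Finset.prod_subset (Finset.subset_univ B)]
    · rw [Finset.prod_congr rfl (g := fun _ => (#A : ℝ)) (fun x hx => by simp [hx])]
      simp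
    · intro x _ hx
      simp [hx]
  have hPmem : ∀ φ, φ ∈ P ↔ (∀ x ∈ B, φ x ∈ A) ∧ ∀ x, x ∉ B → φ x = x := by
    intro φ
    rw [hP, Fintype.mem_piFinset]
    constructor
    · intro h
      exact ⟨fun x hx => by simpa [hx] using h x, fun x hx => by simpa [hx] using h x⟩
    · rintro ⟨h1, h2⟩ x
      by_cases hx : x ∈ B
      · simpa [hx] using h1 x hx
      · simpa [hx] using h2 x hx
  have : ∑ y ∈ P ×ˢ forests B (U \ B), H B y.2
      = (#A : ℝ) ^ #B * ∑ g ∈ forests B (U \ B), H B g := by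
    rw [Finset.sum_product]
    simp only [Finset.sum_const, nsmul_eq_mul, hPcard]
  rw [← this]
  refine Finset.sum_bij' (fun f _ => ((fun x => if x ∈ B then f x else x), cutAt B f))
    (fun y _ => fun x => if x ∈ B then y.1 x else y.2 x) ?_ ?_ ?_ ?_ ?_
  · intro f hf
    obtain ⟨hf, hfB⟩ := Finset.mem_filter.1 hf
    refine Finset.mem_product.2 ⟨(hPmem _).2 ⟨fun x hx => ?_, fun x hx => by simp [hx]⟩, ?_⟩
    · rw [← hfB] at hx
      simpa [← hfB, hx] using (Finset.mem_filter.1 hx).2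
    · simpa [hfB] using cutAt_mem_forests hAU hf
  · rintro ⟨φ, g⟩ hy
    obtain ⟨hφ, hg⟩ := Finset.mem_product.1 hy
    have := graft_mem hAU hBU ((hPmem _).1 hφ).1 hg
    exact Finset.mem_filter.2 ⟨this.1, this.2.1⟩
  · intro f hf
    funext x
    by_cases hx : x ∈ B <;> simp [cutAt, hx]
  · rintro ⟨φ, g⟩ hy
    obtain ⟨hφ, hg⟩ := Finset.mem_product.1 hy
    refine Prod.ext ?_ (graft_mem hAU hBU ((hPmem _).1 hφ).1 hg).2.2
    funext x
    by_cases hx : x ∈ B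
    · simp [hx]
    · simpa [hx] using (((hPmem _).1 hφ).2 x hx).symm
  · intro f hf
    obtain ⟨hf, rfl⟩ := Finset.mem_filter.1 hf
    rfl

lemma forests_empty (A : Finset α) : forests A (∅ : Finset α) = {id} := by
  ext f
  simp [mem_forests, funext_iff]

lemma forestCount_zero {s : ℝ} (hs : s ≠ 0) : forestCount s 0 = 1 := by
  simp [forestCount, hs]

/-- Cayley's formula for forests. -/
lemma card_forests {A U : Finset α} (hAU : Disjoint A U) (hne : (A ∪ U).Nonempty) :
    (#(forests A U) : ℝ) = forestCount #A #U := by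
  induction hn : #U using Nat.strong_induction_on generalizing A U with
  | _ N ih =>
    subst hn
    rcases U.eq_empty_or_nonempty with rfl | hU
    · have hA : (#A : ℝ) ≠ 0 := by
        have : A.Nonempty := by simpa using hne
        exact_mod_cast this.card_pos.ne'
      rw [forests_empty, Finset.card_empty, forestCount_zero hA]
      simp
    · obtain ⟨n, hn⟩ : ∃ n, #U = n + 1 := ⟨#U - 1, by have := hU.card_pos; omega⟩
      have h1 := sum_forests_eq_sum_powerset hAU (fun _ _ => 1)
      have h2 : ∀ B ∈ U.powerset, (#A : ℝ) ^ #B * ∑ g ∈ forests B (U \ B), (1 : ℝ) =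
          (#A : ℝ) ^ #B * (forestCount #B #(U \ B) * 1) := by
        intro B hB
        have hBU := Finset.mem_powerset.1 hB
        rcases B.eq_empty_or_nonempty with rfl | hBne
        · have : forests (∅ : Finset α) (U \ ∅) = ∅ := by
            obtain ⟨x, hx⟩ := hU
            refine Finset.eq_empty_of_forall_notMem fun f hf => ?_
            obtain ⟨k, hk⟩ := (mem_forests.1 hf).2 x (by simpa using hx)
            simp at hk
          rw [this]
          simp [forestCount]
        · have hlt : #(U \ B) < #U := by
            rw [Finset.card_sdiff_of_subset hBU]
            have := hBne.card_pos
            have := hU.card_pos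
            omega
          have := ih _ hlt (A := B) (U := U \ B) Finset.disjoint_sdiff
            (hBne.mono Finset.subset_union_left) rfl
          simp [this]
      rw [Finset.sum_congr rfl h2, sum_powerset_forestCount hn (#A : ℝ) (fun _ => 1)] at h1
      simp only [mul_one, Finset.sum_const, nsmul_eq_mul] at h1
      rw [h1, hn]
      exact sum_choose_eq_forestCount n (Nat.cast_nonneg _)

lemma sum_pow_card_firstGen {A U : Finset α} (hAU : Disjoint A U) (hA : A.Nonempty) {y : ℝ}
    (hy : 0 < y) :
    ∑ f ∈ forests A U, y ^ #(firstGen A U f) = forestCount (y * #A) #U := by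
  rcases U.eq_empty_or_nonempty with rfl | hU
  · have hA' : (#A : ℝ) ≠ 0 := by exact_mod_cast hA.card_pos.ne'
    rw [forests_empty, Finset.card_empty, forestCount_zero (by positivity)]
    simp [firstGen]
  · obtain ⟨n, hn⟩ : ∃ n, #U = n + 1 := ⟨#U - 1, by have := hU.card_pos; omega⟩
    rw [sum_forests_eq_sum_powerset hAU (fun B _ => y ^ #B), hn,
      ← sum_choose_eq_forestCount n (by positivity)]
    have h := sum_powerset_forestCount hn (y * #A) (fun _ => 1)
    simp only [mul_one] at h
    rw [← h]
    refine Finset.sum_congr rfl fun B hB => ?_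
    have hne : (B ∪ U \ B).Nonempty := by
      rwa [Finset.union_sdiff_of_subset (Finset.mem_powerset.1 hB)]
    rw [Finset.sum_const, nsmul_eq_mul, card_forests Finset.disjoint_sdiff hne]
    ring

end Forest

section Binomial

lemma sum_binomial_le {n : ℕ} {a b : ℝ} (ha : 0 < a) (hb : 0 < b) {g : ℕ → ℝ} {u v w : ℝ}
    (hg : ∀ k ≤ n, g k ≤ u + v * (k - n * (a / (a + b))) + w * (k - n * (a / (a + b))) ^ 2) :
    ∑ k ∈ Finset.range (n + 1), n.choose k * a ^ k * b ^ (n - k) * g k ≤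
      (a + b) ^ n * (u + w * (n * (a / (a + b)) * (b / (a + b)))) := by
  set p := a / (a + b) with hp
  have hab : a + b ≠ 0 := by positivity
  have hq : b / (a + b) = 1 - p := by rw [hp]; field_simp; ring
  have hw : ∀ k ∈ Finset.range (n + 1), (n.choose k : ℝ) * a ^ k * b ^ (n - k) =
      (a + b) ^ n * (bernsteinPolynomial ℝ n k).eval p := by
    intro k hk
    have hk' : k ≤ n := Nat.lt_succ_iff.1 (Finset.mem_range.1 hk)
    simp only [bernsteinPolynomial, Polynomial.eval_mul, Polynomial.eval_pow, Polynomial.eval_sub,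
      Polynomial.eval_one, Polynomial.eval_X, Polynomial.eval_natCast]
    rw [← hq, hp, div_pow, div_pow]
    have : (a + b) ^ n = (a + b) ^ k * (a + b) ^ (n - k) := by
      rw [← pow_add, Nat.add_sub_cancel' hk']
    rw [this]
    field_simp
  have h0 := congrArg (Polynomial.eval p) (bernsteinPolynomial.sum ℝ n)
  have h1 := congrArg (Polynomial.eval p) (bernsteinPolynomial.sum_smul ℝ n)
  have h2 := congrArg (Polynomial.eval p) (bernsteinPolynomial.variance ℝ n)
  simp only [Polynomial.eval_finsetSum, Polynomial.eval_mul, Polynomial.eval_pow,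
    Polynomial.eval_sub, Polynomial.eval_one, Polynomial.eval_X, Polynomial.eval_natCast,
    nsmul_eq_mul] at h0 h1 h2
  have hnn : ∀ k ∈ Finset.range (n + 1), 0 ≤ (n.choose k : ℝ) * a ^ k * b ^ (n - k) :=
    fun k _ => by positivity
  calc ∑ k ∈ Finset.range (n + 1), n.choose k * a ^ k * b ^ (n - k) * g k
      ≤ ∑ k ∈ Finset.range (n + 1), n.choose k * a ^ k * b ^ (n - k) *
          (u + v * (k - n * p) + w * (k - n * p) ^ 2) :=
        Finset.sum_le_sum fun k hk => mul_le_mul_of_nonneg_left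
          (hg k (Nat.lt_succ_iff.1 (Finset.mem_range.1 hk))) (hnn k hk)
    _ = (a + b) ^ n * ((u - v * (n * p)) * ∑ k ∈ Finset.range (n + 1),
            (bernsteinPolynomial ℝ n k).eval p
          + v * ∑ k ∈ Finset.range (n + 1), (k : ℝ) * (bernsteinPolynomial ℝ n k).eval p
          + w * ∑ k ∈ Finset.range (n + 1),
            (n * p - k) ^ 2 * (bernsteinPolynomial ℝ n k).eval p) := by
        rw [Finset.mul_sum, Finset.mul_sum, Finset.mul_sum, ← Finset.sum_add_distrib,
          ← Finset.sum_add_distrib, Finset.mul_sum]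
        refine Finset.sum_congr rfl fun k hk => ?_
        rw [hw k hk]
        ring
    _ = _ := by
        rw [h0, h1, h2, hq]
        ring

end Binomial

section Potential

/-- A potential for the chain of generation sizes of a uniform forest, with `q` vertices in the
current generation and `n` vertices in later generations. -/
noncomputable def potential (q n : ℕ) : ℝ :=
  9 * √n - √n / 8 + 2 / √n * (max (√n / 4 - q) 0) ^ 2

lemma potential_nonneg (q n : ℕ) : 0 ≤ potential q n := by
  have : 0 ≤ √(n : ℝ) := Real.sqrt_nonneg _
  have h2 : 0 ≤ 2 / √(n : ℝ) * (max (√n / 4 - q) 0) ^ 2 := by positivity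
  rw [potential]
  linarith

lemma potential_le (q n : ℕ) : potential q n ≤ 9 * √n := by
  rcases (Real.sqrt_nonneg (n : ℝ)).eq_or_lt with h | h
  · simp [potential, ← h]
  · have h1 : max (√(n : ℝ) / 4 - q) 0 ≤ √n / 4 :=
      max_le (by linarith [(Nat.cast_nonneg q : (0 : ℝ) ≤ q)]) (by positivity)
    have h2 : (max (√(n : ℝ) / 4 - q) 0) ^ 2 ≤ (√n / 4) ^ 2 :=
      pow_le_pow_left₀ (le_max_right _ _) h1 2
    have h3 : 2 / √(n : ℝ) * (max (√n / 4 - q) 0) ^ 2 ≤ 2 / √n * (√n / 4) ^ 2 := by gcongr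
    have h4 : 2 / √(n : ℝ) * (√n / 4) ^ 2 = √n / 8 := by field_simp; norm_num
    rw [potential]
    linarith

lemma sq_max_div_mono {s t x : ℝ} (hs : 0 ≤ s) (hst : s ≤ t) (ht : 0 < t) (hx : 0 ≤ x) :
    2 / s * (max (s / 4 - x) 0) ^ 2 ≤ 2 / t * (max (t / 4 - x) 0) ^ 2 := by
  rcases hs.eq_or_lt with rfl | hs
  · simp only [div_zero, zero_mul]; positivity
  rcases le_or_gt (s / 4 - x) 0 with h | h
  · rw [max_eq_right h]
    simp only [ne_eq, OfNat.ofNat_ne_zero, not_false_eq_true, zero_pow, mul_zero]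
    positivity
  · rw [max_eq_left h.le, max_eq_left (by linarith), div_mul_eq_mul_div, div_mul_eq_mul_div,
      div_le_div_iff₀ hs ht]
    have h1 : x ^ 2 ≤ s * t / 16 := by nlinarith
    nlinarith [mul_nonneg (sub_nonneg.2 hst) (sub_nonneg.2 h1)]

lemma potential_sub_le {N x : ℕ} (hx : x ≤ N) (hN : 0 < N) :
    potential x (N - x) ≤
      9 * √N - √N / 8 - 4 * x / √N + 2 / √N * (max (√N / 4 - x) 0) ^ 2 := by
  have hs : 0 < √(N : ℝ) := Real.sqrt_pos.2 (by exact_mod_cast hN)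
  have hss : √(N : ℝ) ^ 2 = N := Real.sq_sqrt (Nat.cast_nonneg _)
  have hx0 : (0 : ℝ) ≤ x := Nat.cast_nonneg _
  have hxN : (x : ℝ) ≤ N := by exact_mod_cast hx
  have h1 : √((N - x : ℕ) : ℝ) ≤ √N - x / (2 * √N) := by
    have h0 : 0 ≤ √(N : ℝ) - x / (2 * √N) := by
      rw [sub_nonneg, div_le_iff₀ (by positivity)]
      nlinarith
    rw [Real.sqrt_le_left h0, Nat.cast_sub hx]
    have : (√(N : ℝ) - x / (2 * √N)) ^ 2 = N - x + (x / (2 * √N)) ^ 2 := by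
      rw [sub_sq, hss]; field_simp
    rw [this]
    nlinarith [sq_nonneg ((x : ℝ) / (2 * √N))]
  have h2 : √((N - x : ℕ) : ℝ) ≤ √N := h1.trans (by
    have : 0 ≤ (x : ℝ) / (2 * √N) := by positivity
    linarith)
  have h3 := sq_max_div_mono (Real.sqrt_nonneg _) h2 hs hx0
  have h4 : 4 * (x : ℝ) / √N = 8 * (x / (2 * √N)) := by field_simp; ring
  have h5 : 0 ≤ (x : ℝ) / (2 * √N) := by positivity
  rw [potential, h4]
  linarith

lemma potential_drift (n q : ℕ) (hq : 0 < q) :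
    q * ∑ b ∈ Finset.range (n + 1), n.choose b * (q : ℝ) ^ b * ((n + 1 : ℕ) : ℝ) ^ (n - b) *
        potential (b + 1) (n - b) ≤
      forestCount q (n + 1) * (potential q (n + 1) - 1 / 4) := by
  set N : ℝ := ((n + 1 : ℕ) : ℝ) with hN
  have hNn : N = n + 1 := by simp [hN]
  have hn0 : (0 : ℝ) ≤ n := Nat.cast_nonneg _
  have hN0 : 0 < N := by rw [hNn]; positivity
  have hN1 : 1 ≤ N := by linarith
  have hq1 : (1 : ℝ) ≤ q := by exact_mod_cast hq
  have hq0 : (0 : ℝ) < q := by linarith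
  set s := √N with hs
  have hs0 : 0 < s := Real.sqrt_pos.2 hN0
  have hss : s ^ 2 = N := Real.sq_sqrt hN0.le
  have hs1 : 1 ≤ s := Real.one_le_sqrt.2 hN1
  set ν := n * ((q : ℝ) / (q + N)) with hν
  have hqN : 0 < (q : ℝ) + N := by positivity
  have hν0 : 0 ≤ ν := by positivity
  have hνeq : ν * (q + N) = n * q := by rw [hν]; field_simp
  have hvar : ν * (N / (q + N)) ≤ ν :=
    mul_le_of_le_one_right hν0 ((div_le_one hqN).2 (by linarith))
  have hvar0 : 0 ≤ ν * (N / (q + N)) := by positivity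
  have hpt : ∀ b ≤ n, potential (b + 1) (n - b) ≤
      9 * s - s / 8 - 4 * ((b : ℝ) + 1) / s + 2 / s * (max (s / 4 - (b + 1)) 0) ^ 2 := by
    intro b hb
    have := potential_sub_le (N := n + 1) (x := b + 1) (by omega) (by omega)
    rw [Nat.add_sub_add_right] at this
    simpa only [← hN, ← hs, Nat.cast_add, Nat.cast_one] using this
  have hfc : forestCount q (n + 1) = q * (q + N) ^ n := by
    rw [forestCount, ← hN, pow_succ]; field_simp
  have hpot : potential q (n + 1) = 9 * s - s / 8 + 2 / s * (max (s / 4 - q) 0) ^ 2 := by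
    rw [potential]
  rw [hfc, mul_assoc]
  refine mul_le_mul_of_nonneg_left ?_ hq0.le
  rw [hpot]
  set t := max (s / 4 - q) 0 with ht
  have ht0 : 0 ≤ t := le_max_right _ _
  have hdiv : ∀ z : ℝ, 4 * z / s = 2 / s * (2 * z) := fun z => by field_simp; ring
  have h14 : (1 : ℝ) / 4 = 2 / s * (s / 8) := by field_simp; norm_num
  rcases lt_or_ge (q : ℝ) (s / 2) with h | h
  · have hμ : q + 1 / 2 ≤ ν + 1 := by
      by_contra hcon
      push Not at hcon
      nlinarith [mul_lt_mul_of_pos_right hcon hqN]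
    have hμ' : ν ≤ q := by
      by_contra hcon
      push Not at hcon
      nlinarith [mul_lt_mul_of_pos_right hcon hqN]
    refine (sum_binomial_le hq0 hN0
      (u := 9 * s - s / 8 + 2 / s * ((t - (ν + 1 - q)) ^ 2 - 2 * (ν + 1)))
      (v := 2 / s * (-2 * (t - (ν + 1 - q)) - 2)) (w := 2 / s) ?_).trans ?_
    · intro b hb
      refine (hpt b hb).trans ?_
      have hm : (max (s / 4 - ((b : ℝ) + 1)) 0) ^ 2 ≤ (t - (b + 1 - q)) ^ 2 := by
        rcases le_total (s / 4 - ((b : ℝ) + 1)) 0 with h1 | h1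
        · rw [max_eq_right h1]; simp only [ne_eq, OfNat.ofNat_ne_zero, not_false_eq_true, zero_pow]
          positivity
        · rw [max_eq_left h1]
          refine pow_le_pow_left₀ h1 ?_ 2
          have := le_max_left (s / 4 - (q : ℝ)) 0
          linarith
      have := mul_le_mul_of_nonneg_left hm (by positivity : 0 ≤ 2 / s)
      rw [hdiv, ← hν]
      linarith
    · refine mul_le_mul_of_nonneg_left ?_ (by positivity)
      rw [h14, ← hν]
      have hts : s / 4 - q ≤ t := le_max_left _ _
      have key : (t - (ν + 1 - q)) ^ 2 - 2 * (ν + 1) + ν * (N / (q + N)) ≤ t ^ 2 - s / 8 := by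
        nlinarith [mul_nonneg ht0 (by linarith : 0 ≤ ν + 1 - q - 1 / 2)]
      have := mul_le_mul_of_nonneg_left key (by positivity : 0 ≤ 2 / s)
      linarith
  · have hM : s / 4 ≤ ν + 1 := by
      refine le_of_mul_le_mul_right ?_ hqN
      have h1 : (ν + 1) * (q + N) = N * q + N := by rw [add_mul, hνeq, hNn]; ring
      have h2 : s ≤ N := by rw [← hss]; nlinarith
      have h3 := mul_le_mul_of_nonneg_right h2 hq0.le
      have h4 : s * N ≤ 2 * q * N := mul_le_mul_of_nonneg_right (by linarith) hN0.le
      have h5 : 0 ≤ N * q := by positivity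
      rw [h1]
      linarith
    refine (sum_binomial_le hq0 hN0
      (u := 9 * s - s / 8 - 2 / s * (2 * (ν + 1)))
      (v := 2 / s * (-2)) (w := 2 / s) ?_).trans ?_
    · intro b hb
      refine (hpt b hb).trans ?_
      have hm : (max (s / 4 - ((b : ℝ) + 1)) 0) ^ 2 ≤ (b - ν) ^ 2 := by
        rcases le_total (s / 4 - ((b : ℝ) + 1)) 0 with h1 | h1
        · rw [max_eq_right h1]; simp only [ne_eq, OfNat.ofNat_ne_zero, not_false_eq_true, zero_pow]
          positivity
        · rw [max_eq_left h1, ← neg_sub ν, neg_sq]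
          refine pow_le_pow_left₀ h1 ?_ 2
          linarith
      have := mul_le_mul_of_nonneg_left hm (by positivity : 0 ≤ 2 / s)
      rw [hdiv, ← hν]
      linarith
    · refine mul_le_mul_of_nonneg_left ?_ (by positivity)
      rw [h14, ← hν]
      have key : -(2 * (ν + 1)) + ν * (N / (q + N)) ≤ t ^ 2 - s / 8 := by
        linarith [sq_nonneg t]
      have := mul_le_mul_of_nonneg_left key (by positivity : 0 ≤ 2 / s)
      linarith

end Potential

section Height

variable {α : Type*} [DecidableEq α]

/-- The height of a forest. -/
noncomputable def forestHeight (A U : Finset α) (f : α → α) : ℕ :=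
  U.sup (depth A f)

variable [Fintype α]

lemma forestHeight_le_succ {A U : Finset α} {f : α → α} (hAU : Disjoint A U)
    (hf : f ∈ forests A U) :
    forestHeight A U f ≤
      forestHeight (firstGen A U f) (U \ firstGen A U f) (cutAt (firstGen A U f) f) + 1 := by
  set B := firstGen A U f with hB
  obtain ⟨hfix, hreach⟩ := mem_forests.1 hf
  have hstep : ∀ k x, (cutAt B f)^[k] x ∈ B → depth A f x ≤ k + 1 := fun k x hx =>
    Nat.sInf_le (iterate_succ_mem_of_cutAt hAU hfix (fun x hx => (Finset.mem_filter.1 hx).2) k x hx)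
  refine Finset.sup_le fun x hx => ?_
  by_cases hxB : x ∈ B
  · exact (hstep 0 x hxB).trans (by omega)
  · obtain ⟨k, hk⟩ := hreach x hx
    have hmem : (cutAt B f)^[depth B (cutAt B f) x] x ∈ B :=
      Nat.sInf_mem (s := {k : ℕ | (cutAt B f)^[k] x ∈ B})
        (exists_cutAt_iterate_mem hAU hfix k x hx hk)
    refine (hstep _ x hmem).trans (Nat.succ_le_succ ?_)
    exact Finset.le_sup (f := depth B (cutAt B f)) (Finset.mem_sdiff.2 ⟨hx, hxB⟩)

lemma sum_exp_forestHeight_le {m : ℕ} (hm : 0 < m) {A U : Finset α} (hAU : Disjoint A U)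
    (hA : A.Nonempty) (hU : #U ≤ m) :
    ∑ f ∈ forests A U, Real.exp (forestHeight A U f / (40 * √m)) ≤
      forestCount #A #U * (1 + potential #A #U / √m) := by
  have hm0 : 0 < √(m : ℝ) := Real.sqrt_pos.2 (by exact_mod_cast hm)
  induction hn : #U using Nat.strong_induction_on generalizing A U with
  | _ N ih =>
    subst hn
    rcases U.eq_empty_or_nonempty with rfl | hUne
    · have hA' : (#A : ℝ) ≠ 0 := by exact_mod_cast hA.card_pos.ne'
      rw [forests_empty, Finset.card_empty, forestCount_zero hA']
      have := div_nonneg (potential_nonneg #A 0) hm0.le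
      simpa [forestHeight] using this
    · obtain ⟨n, hn⟩ : ∃ n, #U = n + 1 := ⟨#U - 1, by have := hUne.card_pos; omega⟩
      set ε := 1 / (40 * √(m : ℝ)) with hε
      have hε0 : 0 < ε := by positivity
      have h1 : ∑ f ∈ forests A U, Real.exp (forestHeight A U f / (40 * √m)) ≤
          Real.exp ε * ∑ B ∈ U.powerset, (#A : ℝ) ^ #B * ∑ g ∈ forests B (U \ B),
            Real.exp (forestHeight B (U \ B) g / (40 * √m)) := by
        rw [← sum_forests_eq_sum_powerset hAU (fun B g =>
          Real.exp (forestHeight B (U \ B) g / (40 * √m))), Finset.mul_sum]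
        refine Finset.sum_le_sum fun f hf => ?_
        rw [← Real.exp_add, Real.exp_le_exp, hε, ← add_div]
        gcongr
        have := forestHeight_le_succ hAU hf
        rw [add_comm]
        exact_mod_cast this
      have h2 : ∑ B ∈ U.powerset, (#A : ℝ) ^ #B * ∑ g ∈ forests B (U \ B),
            Real.exp (forestHeight B (U \ B) g / (40 * √m)) ≤
          ∑ B ∈ U.powerset, (#A : ℝ) ^ #B * (forestCount #B #(U \ B) *
            (fun b => 1 + potential b (n + 1 - b) / √m) #B) := by
        refine Finset.sum_le_sum fun B hB => mul_le_mul_of_nonneg_left ?_ (by positivity)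
        have hBU := Finset.mem_powerset.1 hB
        have hcard : #(U \ B) = n + 1 - #B := by
          rw [Finset.card_sdiff_of_subset hBU, hn]
        rcases B.eq_empty_or_nonempty with rfl | hBne
        · have : forests (∅ : Finset α) (U \ ∅) = ∅ := by
            obtain ⟨x, hx⟩ := hUne
            refine Finset.eq_empty_of_forall_notMem fun f hf => ?_
            obtain ⟨k, hk⟩ := (mem_forests.1 hf).2 x (by simpa using hx)
            simp at hk
          rw [this]
          simp [forestCount]
        · have hlt : #(U \ B) < #U := by
            have := hBne.card_pos
            omega
          have := ih _ hlt (A := B) (U := U \ B) Finset.disjoint_sdiff hBne (by omega) rfl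
          simpa only [← hcard] using this
      replace h2 := h2.trans_eq (sum_powerset_forestCount hn (#A : ℝ)
        fun b => 1 + potential b (n + 1 - b) / √m)
      have hA0 : 0 < #A := hA.card_pos
      have h3 := potential_drift n #A hA0
      have h4 := sum_choose_eq_forestCount n (Nat.cast_nonneg (α := ℝ) #A)
      set F := forestCount (#A : ℝ) (n + 1) with hF
      have hF0 : 0 ≤ F := by rw [hF, forestCount]; positivity
      have h5 : (#A : ℝ) * ∑ b ∈ Finset.range (n + 1), n.choose b * (#A : ℝ) ^ b *
          ((n + 1 : ℕ) : ℝ) ^ (n - b) * (1 + potential (b + 1) (n + 1 - (b + 1)) / √m) ≤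
          F * (1 + potential #A (n + 1) / √m - 1 / (4 * √m)) := by
        have : (#A : ℝ) * ∑ b ∈ Finset.range (n + 1), n.choose b * (#A : ℝ) ^ b *
            ((n + 1 : ℕ) : ℝ) ^ (n - b) * (1 + potential (b + 1) (n + 1 - (b + 1)) / √m) =
            F + (#A * ∑ b ∈ Finset.range (n + 1), n.choose b * (#A : ℝ) ^ b *
              ((n + 1 : ℕ) : ℝ) ^ (n - b) * potential (b + 1) (n - b)) / √m := by
          rw [← h4, mul_div_assoc, Finset.sum_div, ← mul_add, ← Finset.sum_add_distrib]
          congr 1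
          refine Finset.sum_congr rfl fun b _ => ?_
          rw [Nat.add_sub_add_right]
          ring
        rw [this]
        have := div_le_div_of_nonneg_right h3 hm0.le
        calc _ ≤ F + F * (potential #A (n + 1) - 1 / 4) / √m := by linarith
          _ = _ := by field_simp; ring
      rw [hn]
      set X := 1 + potential #A (n + 1) / √m with hX
      have hX10 : X ≤ 10 := by
        have ha := potential_le #A (n + 1)
        have hb : √((n + 1 : ℕ) : ℝ) ≤ √m := Real.sqrt_le_sqrt (by exact_mod_cast hn ▸ hU)
        have hc : potential #A (n + 1) / √m ≤ 9 := by
          rw [div_le_iff₀ hm0]; linarith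
        linarith
      have hX0 : 0 ≤ X := by
        have := div_nonneg (potential_nonneg #A (n + 1)) hm0.le
        linarith
      have h6 : Real.exp ε * (X - 1 / (4 * √m)) ≤ X := by
        have ha : X - 1 / (4 * √m) ≤ X * Real.exp (-ε) := by
          have hb := Real.add_one_le_exp (-ε)
          have hc : 1 / (4 * √(m : ℝ)) = 10 * ε := by rw [hε]; field_simp; norm_num
          rw [hc]
          nlinarith [mul_le_mul_of_nonneg_left hb hX0]
        calc _ ≤ Real.exp ε * (X * Real.exp (-ε)) :=
              mul_le_mul_of_nonneg_left ha (Real.exp_pos _).le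
          _ = X := by rw [Real.exp_neg]; field_simp
      calc _ ≤ Real.exp ε * (F * (X - 1 / (4 * √m))) :=
            h1.trans (mul_le_mul_of_nonneg_left (h2.trans h5) (Real.exp_pos _).le)
        _ = F * (Real.exp ε * (X - 1 / (4 * √m))) := by ring
        _ ≤ F * X := mul_le_mul_of_nonneg_left h6 hF0

end Height

section Spine

variable {α : Type*} [Fintype α] [DecidableEq α]

/-- The vertices at depth `k` in the tree with root `t` of a forest with non-root vertices `U`. -/
noncomputable def generation (k : ℕ) (f : α → α) (U : Finset α) (t : α) : Finset α :=
  univ.filter fun u => f^[k] u = t ∧ ∀ j < k, f^[j] u ∈ U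

/-- The vertices whose parent is a root or one of the `k` last ancestors of `u`. -/
noncomputable def spineChildren (k : ℕ) (f : α → α) (A U : Finset α) (u : α) : Finset α :=
  U.filter fun v => f v ∈ A ∨ ∃ j < k, f v = f^[j] u

lemma mem_generation {k : ℕ} {f : α → α} {U : Finset α} {t u : α} :
    u ∈ generation k f U t ↔ f^[k] u = t ∧ ∀ j < k, f^[j] u ∈ U := by
  simp [generation]

lemma iterate_update_of_mem_generation {k : ℕ} {f : α → α} {A U : Finset α} {t u : α}
    (hAU : Disjoint A U) (ht : t ∈ A) (hu : u ∈ generation (k + 1) f U t) :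
    ∀ j ≤ k, (Function.update f (f^[k] u) (f^[k] u))^[j] u = f^[j] u ∧
      (j < k → f^[j] u ≠ f^[k] u) := by
  obtain ⟨hut, huU⟩ := mem_generation.1 hu
  have hne : ∀ j < k, f^[j] u ≠ f^[k] u := by
    intro j hj heq
    have h1 : f^[j + 1] u = t := by
      rw [Function.iterate_succ_apply', heq, ← Function.iterate_succ_apply' f k u, hut]
    exact Finset.disjoint_left.1 hAU ht (h1 ▸ huU (j + 1) (by omega))
  intro j
  induction j with
  | zero => exact fun _ => ⟨rfl, fun h => hne 0 h⟩
  | succ j ih =>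
    intro hj
    refine ⟨?_, fun h => hne _ h⟩
    rw [Function.iterate_succ_apply', (ih (by omega)).1, Function.iterate_succ_apply',
      Function.update_of_ne (hne j (by omega))]

lemma update_mem_forests {A U : Finset α} {f : α → α} (hf : f ∈ forests A U) (w : α) :
    Function.update f w w ∈ forests (insert w A) (U.erase w) := by
  obtain ⟨hfix, hreach⟩ := mem_forests.1 hf
  have hstep : ∀ k x, f^[k] x ∈ A → ∃ j : ℕ, (Function.update f w w)^[j] x ∈ insert w A := by
    intro k
    induction k with
    | zero => exact fun x hx => ⟨0, Finset.mem_insert_of_mem hx⟩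
    | succ k ih =>
      intro x hx
      by_cases hxw : x = w
      · exact ⟨0, by simp [hxw]⟩
      · obtain ⟨j, hj⟩ := ih (f x) hx
        refine ⟨j + 1, ?_⟩
        rwa [Function.iterate_succ_apply, Function.update_of_ne hxw]
  refine mem_forests.2 ⟨fun x hx => ?_, fun x hx => ?_⟩
  · by_cases hxw : x = w
    · simp [hxw]
    · rw [Function.update_of_ne hxw]
      exact hfix x fun h => hx (Finset.mem_erase.2 ⟨hxw, h⟩)
  · obtain ⟨k, hk⟩ := hreach x (Finset.mem_of_mem_erase hx)
    exact hstep k x hk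

lemma mem_generation_update {k : ℕ} {f : α → α} {A U : Finset α} {t u : α}
    (hAU : Disjoint A U) (ht : t ∈ A) (hu : u ∈ generation (k + 1) f U t) :
    u ∈ generation k (Function.update f (f^[k] u) (f^[k] u)) (U.erase (f^[k] u)) (f^[k] u) := by
  have h := iterate_update_of_mem_generation hAU ht hu
  refine mem_generation.2 ⟨(h k le_rfl).1, fun j hj => ?_⟩
  rw [(h j hj.le).1]
  exact Finset.mem_erase.2 ⟨(h j hj.le).2 hj, (mem_generation.1 hu).2 j (by omega)⟩

lemma card_spineChildren_succ_le {k : ℕ} {f : α → α} {A U : Finset α} {t u : α}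
    (hAU : Disjoint A U) (ht : t ∈ A) (hu : u ∈ generation (k + 1) f U t) :
    #(spineChildren (k + 1) f A U u) ≤ #(spineChildren k (Function.update f (f^[k] u) (f^[k] u))
      (insert (f^[k] u) A) (U.erase (f^[k] u)) u) + 1 := by
  have h := iterate_update_of_mem_generation hAU ht hu
  refine (Finset.card_le_card fun v hv => ?_).trans (Finset.card_insert_le (f^[k] u) _)
  obtain ⟨hvU, hfv⟩ := Finset.mem_filter.1 hv
  by_cases hvw : v = f^[k] u
  · exact Finset.mem_insert.2 (Or.inl hvw)
  · refine Finset.mem_insert_of_mem (Finset.mem_filter.2 ⟨Finset.mem_erase.2 ⟨hvw, hvU⟩, ?_⟩)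
    rw [Function.update_of_ne hvw]
    rcases hfv with hfv | ⟨j, hj, hfv⟩
    · exact Or.inl (Finset.mem_insert_of_mem hfv)
    · rcases (Nat.lt_succ_iff.1 hj).eq_or_lt with rfl | hj
      · exact Or.inl (by rw [hfv]; exact Finset.mem_insert_self _ _)
      · exact Or.inr ⟨j, hj, by rw [hfv, (h j hj.le).1]⟩

lemma sum_pow_spineChildren_le {y : ℝ} (hy : 1 ≤ y) (k : ℕ) {A U : Finset α} {t : α}
    (hAU : Disjoint A U) (ht : t ∈ A) :
    ∑ f ∈ forests A U, ∑ u ∈ generation k f U t, y ^ #(spineChildren k f A U u) ≤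
      y ^ k * (#U).descFactorial k * forestCount (y * (#A + k : ℕ)) (#U - k) := by
  have hy0 : 0 < y := by linarith
  induction k generalizing A U t with
  | zero =>
    have h := sum_pow_card_firstGen hAU ⟨t, ht⟩ hy0
    simp only [pow_zero, Nat.descFactorial_zero, Nat.cast_one, mul_one, one_mul, add_zero,
      Nat.sub_zero]
    rw [← h]
    refine le_of_eq (Finset.sum_congr rfl fun f _ => ?_)
    have : generation 0 f U t = {t} := by ext u; simp [mem_generation]
    rw [this, Finset.sum_singleton]
    simp [spineChildren, firstGen]
  | succ k ih =>
    rw [Finset.sum_sigma']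
    set S := (forests A U).sigma fun f => generation (k + 1) f U t with hS
    set i : (Σ _ : α → α, α) → (Σ _ : α, Σ _ : α → α, α) := fun x =>
      ⟨x.1^[k] x.2, Function.update x.1 (x.1^[k] x.2) (x.1^[k] x.2), x.2⟩ with hi
    set S' : Finset (Σ _ : α, Σ _ : α → α, α) := U.sigma fun w =>
      (forests (insert w A) (U.erase w)).sigma fun g => generation k g (U.erase w) w with hS'
    set G : (Σ _ : α, Σ _ : α → α, α) → ℝ := fun z =>
      y * y ^ #(spineChildren k z.2.1 (insert z.1 A) (U.erase z.1) z.2.2) with hG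
    have hSmem : ∀ x ∈ S, x.1 ∈ forests A U ∧ x.2 ∈ generation (k + 1) x.1 U t :=
      fun x hx => Finset.mem_sigma.1 hx
    have hmaps : ∀ x ∈ S, i x ∈ S' := by
      intro x hx
      obtain ⟨hf, hu⟩ := hSmem x hx
      refine Finset.mem_sigma.2 ⟨(mem_generation.1 hu).2 k (by omega),
        Finset.mem_sigma.2 ⟨update_mem_forests hf _, mem_generation_update hAU ht hu⟩⟩
    have hinj : Set.InjOn i S := by
      rintro ⟨f, u⟩ hx ⟨f', u'⟩ hx' heq
      obtain ⟨hf, hu⟩ := hSmem _ hx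
      obtain ⟨hf', hu'⟩ := hSmem _ hx'
      simp only [hi, Sigma.mk.injEq, heq_eq_eq] at heq
      obtain ⟨h1, h2, h3⟩ := heq
      have hw : f (f^[k] u) = t :=
        (Function.iterate_succ_apply' f k u).symm.trans (mem_generation.1 hu).1
      have hw' : f' (f'^[k] u') = t :=
        (Function.iterate_succ_apply' f' k u').symm.trans (mem_generation.1 hu').1
      have hff' : f = f' := by
        have ha : Function.update (Function.update f (f^[k] u) (f^[k] u)) (f^[k] u) t = f := by
          rw [Function.update_idem, ← hw, Function.update_eq_self]
        have hb : Function.update (Function.update f' (f'^[k] u') (f'^[k] u')) (f'^[k] u') t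
            = f' := by
          rw [Function.update_idem, ← hw', Function.update_eq_self]
        rw [← ha, ← hb, h2, h1]
      simp [hff', h3]
    have h1 : ∑ x ∈ S, y ^ #(spineChildren (k + 1) x.1 A U x.2) ≤ ∑ x ∈ S, G (i x) := by
      refine Finset.sum_le_sum fun x hx => ?_
      obtain ⟨hf, hu⟩ := hSmem x hx
      simp only [hG, hi, ← pow_succ']
      exact pow_le_pow_right₀ hy (card_spineChildren_succ_le hAU ht hu)
    have h2 : ∑ x ∈ S, G (i x) ≤ ∑ z ∈ S', G z := by
      rw [← Finset.sum_image hinj]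
      refine Finset.sum_le_sum_of_subset_of_nonneg (Finset.image_subset_iff.2 hmaps)
        fun z _ _ => ?_
      rw [hG]
      positivity
    have h3 : ∑ z ∈ S', G z ≤ ∑ w ∈ U, y * (y ^ k * (#U - 1).descFactorial k *
        forestCount (y * (#A + 1 + k : ℕ)) (#U - 1 - k)) := by
      rw [hS', Finset.sum_sigma]
      refine Finset.sum_le_sum fun w hw => ?_
      have hwA : w ∉ A := fun h => Finset.disjoint_left.1 hAU h hw
      have hdisj : Disjoint (insert w A) (U.erase w) := by
        rw [Finset.disjoint_insert_left]
        exact ⟨Finset.notMem_erase w U, hAU.mono_right (Finset.erase_subset w U)⟩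
      have h := ih hdisj (Finset.mem_insert_self w A)
      rw [Finset.card_insert_of_notMem hwA, Finset.card_erase_of_mem hw] at h
      rw [Finset.sum_sigma]
      simp only [hG, ← Finset.mul_sum]
      exact mul_le_mul_of_nonneg_left h hy0.le
    refine (h1.trans (h2.trans h3)).trans (le_of_eq ?_)
    rw [Finset.sum_const, nsmul_eq_mul]
    rcases Nat.eq_zero_or_pos #U with hU | hU
    · simp [hU]
    · obtain ⟨n, hn⟩ : ∃ n, #U = n + 1 := ⟨#U - 1, by omega⟩
      rw [hn, Nat.succ_descFactorial_succ, Nat.add_sub_cancel, Nat.add_sub_add_right,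
        add_right_comm #A 1 k, add_assoc #A k 1]
      push_cast
      ring

end Spine

section Area

variable {m : ℕ}

/-- The relation that the parent of `v` is an ancestor of `u`. -/
def ParentIsAncestor (par : Fin m → Fin m) (u v : Fin m) : Prop :=
  ∃ j : ℕ, par^[j] u = par v

lemma stack_pairwise (par : Fin m → Fin m) (r : Fin m) (i : ℕ) :
    (stateAt (childAdj par r) r i).stack.Pairwise (ParentIsAncestor par) := by
  induction i with
  | zero => simp [stateAt]
  | succ i ih =>
    have hs : stateAt (childAdj par r) r (i + 1) =
        step (childAdj par r) (stateAt (childAdj par r) r i) := by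
      simp only [stateAt, Function.iterate_succ_apply']
    rw [hs]
    generalize stateAt (childAdj par r) r i = s at ih
    obtain ⟨stack, visited⟩ := s
    cases stack with
    | nil => simp [step]
    | cons v rest =>
      simp only [step]
      have hlen : ∀ l : List (Fin m), (l.take 1).Pairwise (ParentIsAncestor par) := by
        intro l; cases l <;> simp
      split_ifs
      · exact hlen _
      · obtain ⟨hv, hrest⟩ := List.pairwise_cons.1 ih
        refine List.pairwise_append.2 ⟨?_, hrest, ?_⟩
        · refine List.Pairwise.imp_of_mem (R := fun _ _ => True) ?_ (List.pairwise_of_forall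
            (by simp))
          intro a b ha hb _
          simp only [List.mem_filter, childAdj, Bool.and_eq_true, decide_eq_true_eq] at ha hb
          exact ⟨1, by simp [ha.2.1.1.2, hb.2.1.1.2]⟩
        · intro a ha b hb
          simp only [List.mem_filter, childAdj, Bool.and_eq_true, decide_eq_true_eq] at ha
          obtain ⟨j, hj⟩ := hv b hb
          exact ⟨j + 1, by rw [Function.iterate_succ_apply, ha.2.1.1.2, hj]⟩

lemma area_le (par : Fin m → Fin m) (r : Fin m) :
    area par r ≤ 2 * ∑ u, #(univ.filter fun v => ParentIsAncestor par u v) := by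
  have hsub : permitted par r ⊆
      (univ.filter fun x : Fin m × Fin m => ParentIsAncestor par x.1 x.2) ∪
        (univ.filter fun x : Fin m × Fin m => ParentIsAncestor par x.2 x.1) := by
    intro x hx
    obtain ⟨hne, -, i, -, h1, h2⟩ := (Finset.mem_filter.1 hx).2
    have hp := (stack_pairwise par r i).imp
      (S := fun a b => ParentIsAncestor par a b ∨ ParentIsAncestor par b a) fun h => Or.inl h
    have : Std.Symm fun a b => ParentIsAncestor par a b ∨ ParentIsAncestor par b a :=
      ⟨fun _ _ h => h.symm⟩
    simpa [Finset.mem_union] using hp.forall h1 h2 hne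
  have h1 : #(univ.filter fun x : Fin m × Fin m => ParentIsAncestor par x.1 x.2) =
      ∑ u, #(univ.filter fun v => ParentIsAncestor par u v) := by
    simp only [Finset.card_filter, ← Finset.univ_product_univ, Finset.sum_product]
  have h2 : #(univ.filter fun x : Fin m × Fin m => ParentIsAncestor par x.2 x.1) =
      ∑ u, #(univ.filter fun v => ParentIsAncestor par u v) := by
    simp only [Finset.card_filter, ← Finset.univ_product_univ, Finset.sum_product_right]
  calc area par r ≤ _ := Finset.card_le_card hsub
    _ ≤ _ := Finset.card_union_le _ _
    _ = _ := by rw [h1, h2, two_mul]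

end Area

section SpineBound

lemma descFactorial_le_exp (n k : ℕ) :
    (n.descFactorial k : ℝ) ≤ (n + 1 : ℝ) ^ k * Real.exp (-(k * (k + 1) / (2 * (n + 1)))) := by
  induction k with
  | zero => simp
  | succ k ih =>
    have hn : (0 : ℝ) < n + 1 := by positivity
    have h1 : ((n - k : ℕ) : ℝ) ≤ (n + 1) * Real.exp (-((k + 1) / (n + 1))) := by
      rcases le_or_gt k n with hk | hk
      · rw [Nat.cast_sub hk]
        have h := mul_le_mul_of_nonneg_left (Real.add_one_le_exp (-((k + 1 : ℝ) / (n + 1)))) hn.le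
        refine le_trans (le_of_eq ?_) h
        field_simp
        ring
      · rw [Nat.sub_eq_zero_of_le hk.le]
        simpa using by positivity
    rw [Nat.descFactorial_succ, Nat.cast_mul]
    refine (mul_le_mul h1 ih (by positivity) (by positivity)).trans (le_of_eq ?_)
    rw [mul_mul_mul_comm, ← pow_succ', ← Real.exp_add]
    congr 2
    push_cast
    field_simp
    ring

/-- The exponential rate of the moment generating function of spine areas. -/
noncomputable def spineRate (l : ℝ) : ℝ := l + l * Real.exp l + 1

lemma forestCount_mul_le {n k : ℕ} (hk : k ≤ n) {y : ℝ} (hy : 1 ≤ y) :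
    forestCount (y * (1 + k : ℕ)) (n - k) ≤
      y * (k + 1) * ((n + 1 : ℝ) ^ (n - k) / (n + 1)) * Real.exp ((y - 1) * (k + 1)) := by
  have hn : (0 : ℝ) < n + 1 := by positivity
  have hq : (0 : ℝ) ≤ (y - 1) * (k + 1) := mul_nonneg (by linarith) (by positivity)
  have hD : y * ((1 + k : ℕ) : ℝ) + ((n - k : ℕ) : ℝ) = (n + 1) + (y - 1) * (k + 1) := by
    rw [Nat.cast_sub hk]
    push_cast
    ring
  have h1 : (n + 1 : ℝ) + (y - 1) * (k + 1) ≤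
      (n + 1) * Real.exp ((y - 1) * (k + 1) / (n + 1)) := by
    refine le_trans (le_of_eq ?_)
      (mul_le_mul_of_nonneg_left (Real.add_one_le_exp ((y - 1) * (k + 1) / (n + 1 : ℝ))) hn.le)
    field_simp
    ring
  have h2 : ((n + 1 : ℝ) + (y - 1) * (k + 1)) ^ (n - k) ≤
      (n + 1 : ℝ) ^ (n - k) * Real.exp ((y - 1) * (k + 1)) := by
    refine (pow_le_pow_left₀ (by positivity) h1 _).trans ?_
    rw [mul_pow, ← Real.exp_nat_mul]
    refine mul_le_mul_of_nonneg_left (Real.exp_le_exp.2 ?_) (by positivity)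
    rw [mul_div_assoc', div_le_iff₀ hn, mul_comm]
    refine mul_le_mul_of_nonneg_left ?_ hq
    rw [Nat.cast_sub hk]
    linarith [(k.cast_nonneg : (0 : ℝ) ≤ k)]
  have hy0 : 0 ≤ y := by linarith
  rw [forestCount, hD]
  calc _ ≤ y * ((1 + k : ℕ) : ℝ) * ((n + 1 : ℝ) ^ (n - k) * Real.exp ((y - 1) * (k + 1))) /
        (n + 1) := by
        exact div_le_div₀ (by positivity) (mul_le_mul_of_nonneg_left h2 (by positivity)) hn
          (by linarith)
    _ = _ := by
        push_cast
        ring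

lemma spine_exponent_le {l R q : ℝ} (hl : 0 ≤ l) (hR : 1 ≤ R) (hq : 0 ≤ q) :
    l / R * q + ((Real.exp (l / R) - 1) * q - (q - 1) * q / (2 * R ^ 2)) ≤
      (spineRate l + 1) ^ 2 / 2 - 1 / R * q := by
  have hR0 : 0 < R := by linarith
  have hlR : l / R ≤ l := div_le_self hl hR
  have h1 : Real.exp (l / R) - 1 ≤ l * Real.exp l / R := by
    have h2 := mul_le_mul_of_nonneg_left (Real.add_one_le_exp (-(l / R))) (Real.exp_pos (l / R)).le
    rw [← Real.exp_add, add_neg_cancel, Real.exp_zero] at h2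
    have h3 := mul_le_mul_of_nonneg_left (Real.exp_le_exp.2 hlR) (div_nonneg hl hR0.le)
    rw [mul_div_right_comm]
    linarith
  obtain ⟨s, rfl⟩ : ∃ s, q = s * R := ⟨q / R, by field_simp⟩
  have hs : 0 ≤ s := nonneg_of_mul_nonneg_left hq hR0
  have h4 : (Real.exp (l / R) - 1) * (s * R) ≤ l * Real.exp l * s :=
    (mul_le_mul_of_nonneg_right h1 hq).trans (le_of_eq (by field_simp))
  have h5 : (s * R - 1) * (s * R) / (2 * R ^ 2) = s ^ 2 / 2 - s / (2 * R) := by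
    field_simp
  have h6 : s / (2 * R) ≤ s := div_le_self hs (by linarith)
  have h7 : l / R * (s * R) = l * s := by field_simp
  have h8 : 1 / R * (s * R) = s := by field_simp
  rw [h5, h7, h8, spineRate]
  nlinarith [sq_nonneg (l + l * Real.exp l + 1 + 1 - s)]

lemma spine_term_le {l : ℝ} (hl : 0 ≤ l) (n k : ℕ) :
    Real.exp (l / √(n + 1 : ℝ)) ^ (k + 1) * n.descFactorial k *
        forestCount (Real.exp (l / √(n + 1 : ℝ)) * (1 + k : ℕ)) (n - k) ≤
      Real.exp l * forestCount 1 n * Real.exp ((spineRate l + 1) ^ 2 / 2) *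
        (((k + 1 : ℕ) : ℝ) * Real.exp (-(1 / √(n + 1 : ℝ))) ^ (k + 1)) := by
  set R := √(n + 1 : ℝ) with hR
  set y := Real.exp (l / R) with hy
  have hR1 : 1 ≤ R := Real.one_le_sqrt.2 (by linarith [(n.cast_nonneg : (0 : ℝ) ≤ n)])
  have hR2 : R ^ 2 = n + 1 := Real.sq_sqrt (by positivity)
  have hy1 : 1 ≤ y := Real.one_le_exp (div_nonneg hl (by linarith))
  have hyl : y ≤ Real.exp l := Real.exp_le_exp.2 (div_le_self hl hR1)
  have hN : forestCount 1 n = (n + 1 : ℝ) ^ n / (n + 1) := by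
    rw [forestCount, one_mul, add_comm (1 : ℝ)]
  rcases le_or_gt k n with hk | hk
  · have hpow : (n + 1 : ℝ) ^ k * (n + 1 : ℝ) ^ (n - k) = (n + 1 : ℝ) ^ n := by
      rw [← pow_add, Nat.add_sub_cancel' hk]
    have hexp := Real.exp_le_exp.2 (spine_exponent_le hl hR1 (q := k + 1) (by positivity))
    calc _ ≤ y ^ (k + 1) * ((n + 1 : ℝ) ^ k * Real.exp (-(k * (k + 1) / (2 * (n + 1))))) *
          (y * (k + 1) * ((n + 1 : ℝ) ^ (n - k) / (n + 1)) * Real.exp ((y - 1) * (k + 1))) := by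
          refine mul_le_mul (mul_le_mul_of_nonneg_left (descFactorial_le_exp n k) (by positivity))
            (forestCount_mul_le hk hy1) ?_ (by positivity)
          rw [forestCount]
          positivity
      _ = y * forestCount 1 n * (k + 1) * Real.exp (l / R * (k + 1) +
          ((Real.exp (l / R) - 1) * (k + 1) - (k + 1 - 1) * (k + 1) / (2 * R ^ 2))) := by
          rw [hN, ← hpow, Real.exp_add, sub_eq_add_neg _ ((k + 1 - 1 : ℝ) * _ / _), Real.exp_add,
            hR2, add_sub_cancel_right, ← hy]
          have : y ^ (k + 1) = Real.exp (l / R * (k + 1)) := by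
            rw [hy, ← Real.exp_nat_mul]
            push_cast
            ring_nf
          rw [this]
          ring
      _ ≤ y * forestCount 1 n * (k + 1) *
          Real.exp ((spineRate l + 1) ^ 2 / 2 - 1 / R * (k + 1)) := by
          refine mul_le_mul_of_nonneg_left hexp ?_
          rw [hN]
          positivity
      _ ≤ Real.exp l * forestCount 1 n * (k + 1) *
          Real.exp ((spineRate l + 1) ^ 2 / 2 - 1 / R * (k + 1)) := by
          rw [hN]
          gcongr
      _ = _ := by
          rw [sub_eq_add_neg, Real.exp_add, ← Real.exp_nat_mul]
          push_cast
          ring_nf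
  · rw [Nat.descFactorial_eq_zero_iff_lt.2 hk, hN]
    simp only [Nat.cast_zero, mul_zero, zero_mul]
    positivity

lemma sum_mul_exp_neg_pow_le {R : ℝ} (hR : 1 ≤ R) (K : ℕ) :
    ∑ k ∈ Finset.range K, ((k + 1 : ℕ) : ℝ) * Real.exp (-(1 / R)) ^ (k + 1) ≤ 4 * R ^ 2 := by
  have hR0 : 0 < R := by linarith
  set x := Real.exp (-(1 / R)) with hx
  have hx0 : 0 < x := Real.exp_pos _
  have hx1 : 1 / (2 * R) ≤ 1 - x := by
    have h1 : x ≤ (1 + 1 / R)⁻¹ := by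
      rw [hx, Real.exp_neg]
      exact inv_anti₀ (by positivity) (by linarith [Real.add_one_le_exp (1 / R)])
    have h2 : 1 / (2 * R) ≤ 1 - (1 + 1 / R)⁻¹ := by
      have : 1 - (1 + 1 / R)⁻¹ = 1 / (R + 1) := by field_simp; ring
      rw [this]
      exact one_div_le_one_div_of_le (by linarith) (by linarith)
    linarith
  have hlt : x < 1 := by
    have : 0 < 1 / (2 * R) := by positivity
    linarith
  have hs := hasSum_coe_mul_geometric_of_norm_lt_one (𝕜 := ℝ) (r := x)
    (by rwa [Real.norm_of_nonneg hx0.le])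
  calc _ ≤ ∑ k ∈ Finset.range (K + 1), (k : ℝ) * x ^ k := by
        rw [Finset.sum_range_succ']
        simp
    _ ≤ x / (1 - x) ^ 2 := sum_le_hasSum _ (fun k _ => by positivity) hs
    _ ≤ 1 / (1 / (2 * R)) ^ 2 := by gcongr
    _ = 4 * R ^ 2 := by field_simp; ring

end SpineBound

section Trees

variable {m : ℕ}

lemma treeFinset_eq_forests (r : Fin m) : treeFinset m r = forests {r} (univ.erase r) := by
  ext f
  rw [mem_forests, treeFinset, Finset.mem_filter]
  simp only [IsPTree, Finset.mem_univ, true_and, Finset.mem_erase, and_true,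
    Finset.mem_singleton, ne_eq, not_not, forall_eq]
  refine and_congr_right fun _ => ⟨fun h x _ => h x, fun h x => ?_⟩
  by_cases hx : x = r
  · exact ⟨0, hx⟩
  · exact h x hx

lemma card_treeFinset (n : ℕ) (r : Fin (n + 1)) :
    (#(treeFinset (n + 1) r) : ℝ) = forestCount 1 n := by
  rw [treeFinset_eq_forests, card_forests (by simp) (by simp)]
  simp

lemma hgt_eq_depth (f : Fin m → Fin m) (r u : Fin m) : hgt f r u = depth {r} f u := by
  simp [hgt, depth]

lemma iterate_hgt {f : Fin m → Fin m} {r : Fin m} (hf : IsPTree f r) (u : Fin m) :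
    f^[hgt f r u] u = r :=
  Nat.sInf_mem (s := {k : ℕ | f^[k] u = r}) (hf.2 u)

lemma treeHeight_eq_forestHeight (f : Fin m → Fin m) (r : Fin m) :
    treeHeight f r = forestHeight {r} (univ.erase r) f := by
  rw [treeHeight, forestHeight]
  refine le_antisymm (Finset.sup_le fun u _ => ?_)
    (Finset.sup_le fun u _ => (hgt_eq_depth f r u).symm.le.trans
      (Finset.le_sup (f := hgt f r) (Finset.mem_univ u)))
  by_cases hu : u = r
  · have : hgt f r u = 0 := Nat.sInf_eq_zero.2 (Or.inl hu)
    omega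
  · rw [hgt_eq_depth]
    exact Finset.le_sup (f := depth {r} f) (Finset.mem_erase.2 ⟨hu, Finset.mem_univ u⟩)

lemma mem_generation_hgt {f : Fin m → Fin m} {r : Fin m} (hf : IsPTree f r) (u : Fin m) :
    u ∈ generation (hgt f r u) f (univ.erase r) r := by
  refine mem_generation.2 ⟨iterate_hgt hf u, fun j hj => Finset.mem_erase.2 ⟨fun h => ?_,
    Finset.mem_univ _⟩⟩
  exact Nat.notMem_of_lt_sInf hj h

lemma card_parentIsAncestor_le {f : Fin m → Fin m} {r : Fin m} (hf : IsPTree f r) (u : Fin m) :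
    #(univ.filter fun v => ParentIsAncestor f u v) ≤
      #(spineChildren (hgt f r u) f {r} (univ.erase r) u) + 1 := by
  refine (Finset.card_le_card fun v hv => ?_).trans (Finset.card_insert_le r _)
  obtain ⟨j, hj⟩ := (Finset.mem_filter.1 hv).2
  by_cases hvr : v = r
  · exact Finset.mem_insert.2 (Or.inl hvr)
  refine Finset.mem_insert_of_mem (Finset.mem_filter.2
    ⟨Finset.mem_erase.2 ⟨hvr, Finset.mem_univ v⟩, ?_⟩)
  rcases lt_or_ge j (hgt f r u) with h | h
  · exact Or.inr ⟨j, h, hj.symm⟩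
  · left
    obtain ⟨i, rfl⟩ := Nat.exists_eq_add_of_le' h
    rw [← hj, Function.iterate_add_apply, iterate_hgt hf, Function.iterate_fixed hf.1]
    exact Finset.mem_singleton_self r

lemma sum_pow_card_parentIsAncestor_le {l : ℝ} (hl : 0 ≤ l) (n : ℕ) (r : Fin (n + 1)) :
    ∑ f ∈ treeFinset (n + 1) r, ∑ u,
        Real.exp (l / √(n + 1 : ℝ)) ^ #(univ.filter fun v => ParentIsAncestor f u v) ≤
      4 * Real.exp l * Real.exp ((spineRate l + 1) ^ 2 / 2) * (n + 1) * forestCount 1 n := by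
  set R := √(n + 1 : ℝ) with hR
  set y := Real.exp (l / R) with hy
  have hR1 : 1 ≤ R := Real.one_le_sqrt.2 (by linarith [(n.cast_nonneg : (0 : ℝ) ≤ n)])
  have hR2 : R ^ 2 = n + 1 := Real.sq_sqrt (by positivity)
  have hy1 : 1 ≤ y := Real.one_le_exp (div_nonneg hl (by linarith))
  have hy0 : 0 < y := by linarith
  set K := univ.sup (fun f : Fin (n + 1) → Fin (n + 1) => treeHeight f r) + 1 with hK
  have hlt : ∀ f u, hgt f r u < K := fun f u => Nat.lt_succ_iff.2
    ((Finset.le_sup (f := hgt f r) (Finset.mem_univ u)).trans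
      (Finset.le_sup (f := fun f => treeHeight f r) (Finset.mem_univ f)))
  calc _ ≤ ∑ f ∈ treeFinset (n + 1) r, ∑ k ∈ Finset.range K,
        ∑ u ∈ generation k f (univ.erase r) r,
          y * y ^ #(spineChildren k f {r} (univ.erase r) u) := by
        refine Finset.sum_le_sum fun f hf => ?_
        have hf' : IsPTree f r := (Finset.mem_filter.1 hf).2
        rw [← Finset.sum_fiberwise_of_maps_to (t := Finset.range K) (g := hgt f r)
          fun u _ => Finset.mem_range.2 (hlt f u)]
        refine Finset.sum_le_sum fun k _ => ?_
        refine (Finset.sum_le_sum fun u hu => ?_).trans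
          (Finset.sum_le_sum_of_subset_of_nonneg (s := univ.filter fun u => hgt f r u = k) ?_
            fun u _ _ => by positivity)
        · obtain rfl := (Finset.mem_filter.1 hu).2
          rw [← pow_succ']
          exact pow_le_pow_right₀ hy1 (card_parentIsAncestor_le hf' u)
        · intro u hu
          obtain rfl := (Finset.mem_filter.1 hu).2
          exact mem_generation_hgt hf' u
    _ = ∑ k ∈ Finset.range K, y * ∑ f ∈ forests {r} (univ.erase r),
        ∑ u ∈ generation k f (univ.erase r) r,
          y ^ #(spineChildren k f {r} (univ.erase r) u) := by
        rw [Finset.sum_comm, treeFinset_eq_forests]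
        simp only [Finset.mul_sum]
    _ ≤ ∑ k ∈ Finset.range K, Real.exp l * forestCount 1 n *
        Real.exp ((spineRate l + 1) ^ 2 / 2) *
          (((k + 1 : ℕ) : ℝ) * Real.exp (-(1 / R)) ^ (k + 1)) := by
        refine Finset.sum_le_sum fun k _ => ?_
        have h := mul_le_mul_of_nonneg_left (sum_pow_spineChildren_le hy1 k (A := {r})
          (U := univ.erase r) (by simp) (Finset.mem_singleton_self r)) hy0.le
        refine h.trans (le_trans (le_of_eq ?_) (spine_term_le hl n k))
        rw [Finset.card_singleton, Finset.card_erase_of_mem (Finset.mem_univ r),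
          Finset.card_univ, Fintype.card_fin, Nat.add_sub_cancel, pow_succ']
        ring
    _ = Real.exp l * forestCount 1 n * Real.exp ((spineRate l + 1) ^ 2 / 2) *
        ∑ k ∈ Finset.range K, ((k + 1 : ℕ) : ℝ) * Real.exp (-(1 / R)) ^ (k + 1) := by
        rw [Finset.mul_sum]
    _ ≤ Real.exp l * forestCount 1 n * Real.exp ((spineRate l + 1) ^ 2 / 2) * (4 * R ^ 2) := by
        refine mul_le_mul_of_nonneg_left (sum_mul_exp_neg_pow_le hR1 K) ?_
        rw [forestCount]
        positivity
    _ = _ := by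
        rw [hR2]
        ring

lemma exp_area_le {l : ℝ} (hl : 0 ≤ l) (n : ℕ) (f : Fin (n + 1) → Fin (n + 1))
    (r : Fin (n + 1)) :
    Real.exp (l / 2 * (area f r / ((n + 1) * √(n + 1 : ℝ)))) ≤
      (∑ u, Real.exp (l / √(n + 1 : ℝ)) ^ #(univ.filter fun v => ParentIsAncestor f u v)) /
        (n + 1) := by
  set R := √(n + 1 : ℝ) with hR
  have hR0 : 0 < R := Real.sqrt_pos.2 (by positivity)
  have hn : (0 : ℝ) < n + 1 := by positivity
  set W : Fin (n + 1) → ℕ := fun u => #(univ.filter fun v => ParentIsAncestor f u v) with hW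
  have hJ := convexOn_exp.map_sum_le (t := Finset.univ)
    (w := fun _ : Fin (n + 1) => 1 / (n + 1 : ℝ)) (p := fun u => W u * (l / R))
    (fun _ _ => by positivity) (by simp; field_simp) (fun _ _ => Set.mem_univ _)
  simp only [smul_eq_mul, ← Finset.mul_sum, Real.exp_nat_mul] at hJ
  rw [div_eq_inv_mul _ (n + 1 : ℝ), ← one_div]
  refine le_trans (Real.exp_le_exp.2 ?_) hJ
  rw [← Finset.sum_mul]
  have ha : (area f r : ℝ) ≤ 2 * ∑ u, (W u : ℝ) := by exact_mod_cast area_le f r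
  calc l / 2 * (area f r / ((n + 1) * R)) ≤ l / 2 * ((2 * ∑ u, (W u : ℝ)) / ((n + 1) * R)) := by
        gcongr
    _ = _ := by
        field_simp

lemma sum_exp_area_le {l : ℝ} (hl : 0 ≤ l) (n : ℕ) (r : Fin (n + 1)) :
    ∑ f ∈ treeFinset (n + 1) r, Real.exp (l / 2 * (area f r / ((n + 1) * √(n + 1 : ℝ)))) ≤
      4 * Real.exp l * Real.exp ((spineRate l + 1) ^ 2 / 2) * #(treeFinset (n + 1) r) := by
  have hn : (0 : ℝ) < n + 1 := by positivity
  refine (Finset.sum_le_sum fun f _ => exp_area_le hl n f r).trans ?_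
  rw [← Finset.sum_div, div_le_iff₀ hn, card_treeFinset]
  exact (sum_pow_card_parentIsAncestor_le hl n r).trans (le_of_eq (by ring))

lemma sum_exp_treeHeight_le (n : ℕ) (r : Fin (n + 1)) :
    ∑ f ∈ treeFinset (n + 1) r, Real.exp (treeHeight f r / (40 * √(n + 1 : ℝ))) ≤
      10 * #(treeFinset (n + 1) r) := by
  have hR0 : 0 < √(n + 1 : ℝ) := Real.sqrt_pos.2 (by positivity)
  have hcard : #(univ.erase r) = n := by simp
  have h := sum_exp_forestHeight_le (m := n + 1) n.succ_pos (A := {r}) (U := univ.erase r)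
    (by simp) (Finset.singleton_nonempty r) (by omega)
  rw [hcard, Finset.card_singleton, Nat.cast_one, ← card_treeFinset n r,
    ← treeFinset_eq_forests] at h
  push_cast at h
  simp only [treeHeight_eq_forestHeight]
  refine h.trans ?_
  rw [mul_comm (10 : ℝ)]
  refine mul_le_mul_of_nonneg_left ?_ (by positivity)
  have h1 : potential 1 n / √(n + 1 : ℝ) ≤ 9 := by
    rw [div_le_iff₀ hR0]
    refine (potential_le 1 n).trans ?_
    gcongr
    linarith
  linarith

lemma sum_treeHeight_pow_le (n : ℕ) (r : Fin (n + 1)) :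
    ∑ f ∈ treeFinset (n + 1) r, (treeHeight f r / √(n + 1 : ℝ)) ^ 8 ≤
      (8).factorial * 40 ^ 8 * 10 * #(treeFinset (n + 1) r) := by
  have hR0 : 0 < √(n + 1 : ℝ) := Real.sqrt_pos.2 (by positivity)
  have h : ∀ f : Fin (n + 1) → Fin (n + 1), (treeHeight f r / √(n + 1 : ℝ)) ^ 8 ≤
      (8).factorial * 40 ^ 8 * Real.exp (treeHeight f r / (40 * √(n + 1 : ℝ))) := by
    intro f
    have h1 := Real.pow_div_factorial_le_exp (treeHeight f r / (40 * √(n + 1 : ℝ)))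
      (by positivity) 8
    rw [div_le_iff₀ (by positivity)] at h1
    have h2 : (treeHeight f r / √(n + 1 : ℝ)) ^ 8 =
        40 ^ 8 * (treeHeight f r / (40 * √(n + 1 : ℝ))) ^ 8 := by
      rw [← mul_pow]
      congr 1
      field_simp
    rw [h2]
    linarith [mul_le_mul_of_nonneg_left h1 (show (0 : ℝ) ≤ 40 ^ 8 by positivity)]
  refine (Finset.sum_le_sum fun f _ => h f).trans ?_
  rw [← Finset.mul_sum, mul_assoc _ (10 : ℝ)]
  exact mul_le_mul_of_nonneg_left (sum_exp_treeHeight_le n r) (by positivity)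

end Trees

section Bias

lemma inv_one_sub_pow_le_exp {p : ℝ} (hp0 : 0 ≤ p) (hp : p ≤ 1 / 2) (a : ℕ) :
    ((1 - p) ^ a)⁻¹ ≤ Real.exp (2 * p * a) := by
  have h1 : Real.exp (-(2 * p)) ≤ 1 - p := by
    rw [Real.exp_neg]
    refine (inv_anti₀ (by linarith) (Real.add_one_le_exp (2 * p))).trans ?_
    rw [inv_le_iff_one_le_mul₀ (by linarith)]
    nlinarith
  calc ((1 - p) ^ a)⁻¹ ≤ (Real.exp (-(2 * p)) ^ a)⁻¹ := by
        gcongr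
    _ = Real.exp (2 * p * a) := by
        rw [← Real.exp_nat_mul, ← Real.exp_neg]
        ring_nf

lemma biasedExp_le {n : ℕ} {p : ℝ} (hp0 : 0 ≤ p) (hp : p < 1)
    {f : (Fin (n + 1) → Fin (n + 1)) → Fin (n + 1) → ℝ} (hf : ∀ par r, 0 ≤ f par r) {C : ℝ}
    (h : ∀ r, ∑ par ∈ treeFinset (n + 1) r, ((1 - p) ^ area par r)⁻¹ * f par r ≤
      C * #(treeFinset (n + 1) r)) :
    biasedExp (n + 1) p f ≤ C := by
  rw [biasedExp, dif_pos n.succ_pos]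
  set r : Fin (n + 1) := ⟨0, n.succ_pos⟩
  have hw : ∀ par : Fin (n + 1) → Fin (n + 1), 1 ≤ ((1 - p) ^ area par r)⁻¹ := fun par =>
    (one_le_inv₀ (pow_pos (by linarith) _)).2 (pow_le_one₀ (by linarith) (by linarith))
  have hN : (0 : ℝ) < #(treeFinset (n + 1) r) := by
    rw [card_treeFinset, forestCount]
    positivity
  have hsum : (#(treeFinset (n + 1) r) : ℝ) ≤
      ∑ par ∈ treeFinset (n + 1) r, ((1 - p) ^ area par r)⁻¹ := by
    simpa using Finset.sum_le_sum fun par (_ : par ∈ treeFinset (n + 1) r) => hw par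
  calc _ ≤ (∑ par ∈ treeFinset (n + 1) r, ((1 - p) ^ area par r)⁻¹ * f par r) /
        #(treeFinset (n + 1) r) := by
        refine div_le_div_of_nonneg_left (Finset.sum_nonneg fun par _ => ?_) hN hsum
        exact mul_nonneg (zero_le_one.trans (hw par)) (hf par r)
    _ ≤ C := (div_le_iff₀ hN).2 (h r)

/-- The factor in the bound on the exponential moments of the area. -/
noncomputable def areaConst : ℝ := 4 * Real.exp 16 * Real.exp ((spineRate 16 + 1) ^ 2 / 2)

lemma areaConst_pos : 0 < areaConst := by
  rw [areaConst]
  positivity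

/-- The factor in the bound on the eighth moment of the height. -/
noncomputable def heightConst : ℝ := (8).factorial * 40 ^ 8 * 10

lemma heightConst_pos : 0 < heightConst := by
  rw [heightConst]
  positivity

lemma weight_le_exp {n m : ℕ} {p : ℝ} (hp0 : 0 ≤ p) (hp : p ≤ 1 / 2)
    (hpm : p * ((n + 1) * √(n + 1 : ℝ)) ≤ 2) (f : Fin m → Fin m) (r : Fin m) :
    ((1 - p) ^ area f r)⁻¹ ≤ Real.exp (4 * (area f r / ((n + 1) * √(n + 1 : ℝ)))) := by
  have hD : 0 < (n + 1) * √(n + 1 : ℝ) := by positivity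
  refine (inv_one_sub_pow_le_exp hp0 hp _).trans (Real.exp_le_exp.2 ?_)
  rw [mul_div_assoc', le_div_iff₀ hD]
  nlinarith [mul_le_mul_of_nonneg_right hpm (Nat.cast_nonneg (α := ℝ) (area f r))]

lemma biasedExp_treeHeight_le {n : ℕ} {p : ℝ} (hp0 : 0 ≤ p) (hp : p ≤ 1 / 2)
    (hpm : p * ((n + 1) * √(n + 1 : ℝ)) ≤ 2) :
    biasedExp (n + 1) p (fun par r => (treeHeight par r : ℝ) ^ 4) ≤
      (areaConst + heightConst) * (n + 1) ^ 2 := by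
  refine biasedExp_le hp0 (by linarith) (fun _ _ => by positivity) fun r => ?_
  have hR : √(n + 1 : ℝ) ^ 2 = n + 1 := Real.sq_sqrt (by positivity)
  have hR0 : 0 < √(n + 1 : ℝ) := Real.sqrt_pos.2 (by positivity)
  have hterm : ∀ par : Fin (n + 1) → Fin (n + 1),
      ((1 - p) ^ area par r)⁻¹ * (treeHeight par r : ℝ) ^ 4 ≤ (n + 1) ^ 2 *
        (Real.exp (16 / 2 * (area par r / ((n + 1) * √(n + 1 : ℝ)))) +
          (treeHeight par r / √(n + 1 : ℝ)) ^ 8) := by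
    intro par
    set t : ℝ := area par r / ((n + 1) * √(n + 1 : ℝ))
    set s : ℝ := treeHeight par r / √(n + 1 : ℝ) with hs
    have h1 : (treeHeight par r : ℝ) ^ 4 = (n + 1) ^ 2 * s ^ 4 := by
      rw [hs, div_pow, show √(n + 1 : ℝ) ^ 4 = (√(n + 1 : ℝ) ^ 2) ^ 2 by ring, hR]
      field_simp
    have h2 : Real.exp (16 / 2 * t) = Real.exp (4 * t) ^ 2 := by
      rw [← Real.exp_nat_mul]
      ring_nf
    have h3 : Real.exp (4 * t) * s ^ 4 ≤ Real.exp (16 / 2 * t) + s ^ 8 := by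
      rw [h2]
      nlinarith [sq_nonneg (Real.exp (4 * t) - s ^ 4), sq_nonneg (Real.exp (4 * t)),
        sq_nonneg (s ^ 4)]
    rw [h1, mul_left_comm]
    refine mul_le_mul_of_nonneg_left (le_trans ?_ h3) (by positivity)
    exact mul_le_mul_of_nonneg_right (weight_le_exp hp0 hp hpm par r) (by positivity)
  refine (Finset.sum_le_sum fun par _ => hterm par).trans ?_
  rw [← Finset.mul_sum, Finset.sum_add_distrib]
  have h4 := add_le_add (sum_exp_area_le (l := 16) (by norm_num) n r) (sum_treeHeight_pow_le n r)
  refine (mul_le_mul_of_nonneg_left h4 (by positivity)).trans (le_of_eq ?_)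
  rw [areaConst, heightConst]
  ring

lemma biasedExp_area_le {n : ℕ} {p : ℝ} (hp0 : 0 ≤ p) (hp : p ≤ 1 / 2)
    (hpm : p * ((n + 1) * √(n + 1 : ℝ)) ≤ 2) :
    biasedExp (n + 1) p (fun par r => (area par r : ℝ) ^ 2) ≤ 2 * areaConst * (n + 1) ^ 3 := by
  refine biasedExp_le hp0 (by linarith) (fun _ _ => by positivity) fun r => ?_
  have hR : √(n + 1 : ℝ) ^ 2 = n + 1 := Real.sq_sqrt (by positivity)
  have hR0 : 0 < √(n + 1 : ℝ) := Real.sqrt_pos.2 (by positivity)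
  have hterm : ∀ par : Fin (n + 1) → Fin (n + 1),
      ((1 - p) ^ area par r)⁻¹ * (area par r : ℝ) ^ 2 ≤ 2 * (n + 1) ^ 3 *
        Real.exp (16 / 2 * (area par r / ((n + 1) * √(n + 1 : ℝ)))) := by
    intro par
    set t : ℝ := area par r / ((n + 1) * √(n + 1 : ℝ)) with ht
    have ht0 : 0 ≤ t := by positivity
    have h1 : (area par r : ℝ) ^ 2 = (n + 1) ^ 3 * t ^ 2 := by
      rw [ht, div_pow, mul_pow, hR]
      field_simp
    have h2 : t ^ 2 ≤ 2 * Real.exp (4 * t) := by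
      have := Real.quadratic_le_exp_of_nonneg (show 0 ≤ 4 * t by positivity)
      nlinarith
    have h3 : Real.exp (16 / 2 * t) = Real.exp (4 * t) * Real.exp (4 * t) := by
      rw [← Real.exp_add]
      ring_nf
    calc _ ≤ Real.exp (4 * t) * ((n + 1) ^ 3 * (2 * Real.exp (4 * t))) := by
          rw [h1]
          have := weight_le_exp hp0 hp hpm par r
          gcongr
      _ = _ := by
          rw [h3]
          ring
  refine (Finset.sum_le_sum fun par _ => hterm par).trans ?_
  rw [← Finset.mul_sum]
  have h4 := sum_exp_area_le (l := 16) (by norm_num) n r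
  refine (mul_le_mul_of_nonneg_left h4 (by positivity)).trans (le_of_eq ?_)
  rw [areaConst]
  ring

end Bias

end RandomTree
open RandomTree in
/-- There is a constant `M > 0` such that for all sufficiently large
`n`, all `p` with `1/(2n) < p < 2/n` and all `1 ≤ m ≤ n^{2/3}`, the random tree `T_m`
(uniform labelled tree on `[m]` rooted at `1`, biased by `(1-p)^{-a(·)}`) satisfies
`E[‖T_m‖⁴] ≤ M·m²` and `E[a(T_m)²] ≤ M·m³`. -/
theorem biased_tree_height_and_area_moments :
    ∃ M : ℝ, 0 < M ∧ ∃ N : ℕ, ∀ n : ℕ, N ≤ n → ∀ p : ℝ,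
      1 / (2 * (n:ℝ)) < p → p < 2 / (n:ℝ) →
      ∀ m : ℕ, 1 ≤ m → (m:ℝ) ≤ (n:ℝ) ^ ((2:ℝ)/3) →
        biasedExp m p (fun par r => (treeHeight par r : ℝ) ^ 4) ≤ M * (m:ℝ) ^ 2 ∧
        biasedExp m p (fun par r => (area par r : ℝ) ^ 2) ≤ M * (m:ℝ) ^ 3 := by
  have hA := areaConst_pos
  have hH := heightConst_pos
  refine ⟨2 * areaConst + heightConst, by positivity, 4, fun n hn p hp1 hp2 m hm hmn => ?_⟩
  obtain ⟨k, rfl⟩ : ∃ k, m = k + 1 := ⟨m - 1, by omega⟩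
  have hn0 : (4 : ℝ) ≤ n := by exact_mod_cast hn
  have hp0 : 0 ≤ p := (show (0 : ℝ) ≤ 1 / (2 * n) by positivity).trans hp1.le
  have hpn : p * n ≤ 2 := ((lt_div_iff₀ (by linarith)).1 hp2).le
  have hp : p ≤ 1 / 2 := by nlinarith
  push_cast at hmn ⊢
  have hk : (k + 1 : ℝ) * √(k + 1 : ℝ) ≤ n := by
    have h1 : (k + 1 : ℝ) * √(k + 1 : ℝ) = (k + 1 : ℝ) ^ ((3 : ℝ) / 2) := by
      rw [Real.sqrt_eq_rpow, ← Real.rpow_one_add' (by positivity) (by norm_num)]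
      norm_num
    rw [h1]
    refine (Real.rpow_le_rpow (by positivity) hmn (by norm_num)).trans (le_of_eq ?_)
    rw [← Real.rpow_mul (by positivity)]
    norm_num
  have hpm : p * ((k + 1) * √(k + 1 : ℝ)) ≤ 2 := (mul_le_mul_of_nonneg_left hk hp0).trans hpn
  refine ⟨(biasedExp_treeHeight_le hp0 hp hpm).trans ?_, (biasedExp_area_le hp0 hp hpm).trans ?_⟩
  · gcongr
    linarith
  · gcongr
    linarith
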